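/- Every 5-regular graph has a [2, 3]-factor each of whose connected components is a regular graph; that is, it has a spanning subgraph H = H_1 ∪ H_2 where H_1 and H_2 are vertex-disjoint, H_1 is 2-regular, and H_2 is 3-regular (either part possibly empty). -/

import Mathlib

/-- A finite undirected multigraph without loops: `E` indexes the edges, and each
edge has an unordered pair of distinct endpoints (parallel edges are allowed). -/
structure Multigraph (V : Type*) (E : Type*) where
  ends : E → Sym2 V
  loopless : ∀ e, ¬ (ends e).IsDiag

namespace Multigraph

variable {V E : Type*}

/-- The edges incident with a vertex `v`. -/
def incidence (G : Multigraph V E) [Fintype E] [DecidableEq V] (v : V) : Finset E :=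
  Finset.univ.filter fun e => v ∈ G.ends e

/-- The degree of a vertex `v`. -/
def degree (G : Multigraph V E) [Fintype E] [DecidableEq V] (v : V) : ℕ :=
  (G.incidence v).card

/-- The degree of a vertex `v` in the spanning subgraph with edge set `F`. -/
def degIn (G : Multigraph V E) [Fintype E] [DecidableEq V] (F : Finset E) (v : V) : ℕ :=
  (F.filter fun e => v ∈ G.ends e).card

/-- The simple graph on `V` whose adjacencies are realised by the edges in `F`;
used to speak about reachability/connectivity in the subgraph with edge set `F`. -/
def supportGraph (G : Multigraph V E) (F : Set E) : SimpleGraph V where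
  Adj v w := v ≠ w ∧ ∃ e ∈ F, G.ends e = s(v, w)
  symm := by
    constructor
    rintro v w ⟨hvw, e, he, hee⟩
    refine ⟨hvw.symm, e, he, ?_⟩
    rwa [Sym2.eq_swap]
  loopless := by constructor; rintro v ⟨h, -⟩; exact h rfl

/-- A zero-sum flow: nonzero integer values on the edges summing to zero at
every vertex. -/
def IsZeroSumFlow (G : Multigraph V E) [Fintype E] [DecidableEq V] (f : E → ℤ) : Prop :=
  (∀ e, f e ≠ 0) ∧ ∀ v, ∑ e ∈ G.incidence v, f e = 0

/-- A zero-sum `k`-flow: a zero-sum flow with values in `{±1, …, ±(k-1)}`. -/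
def IsZeroSumKFlow (G : Multigraph V E) [Fintype E] [DecidableEq V] (k : ℕ) (f : E → ℤ) : Prop :=
  G.IsZeroSumFlow f ∧ ∀ e, |f e| ≤ (k : ℤ) - 1

end Multigraph

namespace SimpleGraph

/-- The obstruction to a perfect matching from Tutte's theorem, phrased with finsets and
with the parity gain available when the number of vertices is even. -/
theorem exists_odd_components_of_no_perfectMatching {T : Type*} [Fintype T] [DecidableEq T]
    (H : SimpleGraph T) (heven : Even (Fintype.card T))
    (hH : ∀ M : H.Subgraph, ¬ M.IsPerfectMatching) :
    ∃ (S : Finset T) (𝒟 : Finset (Finset T)), S.card + 2 ≤ 𝒟.card ∧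
      (∀ D ∈ 𝒟, Odd D.card) ∧ (𝒟 : Set (Finset T)).PairwiseDisjoint id ∧
      (∀ D ∈ 𝒟, Disjoint D S) ∧ ∀ D ∈ 𝒟, ∀ x ∈ D, ∀ y ∉ D, H.Adj x y → y ∈ S := by
  classical
  have hex : ∃ u : Set T, H.IsTutteViolator u := by
    by_contra! h
    obtain ⟨M, hM⟩ := tutte.2 h
    exact hH M hM
  obtain ⟨u, hu⟩ := hex
  unfold IsTutteViolator at hu
  set G' := ((⊤ : H.Subgraph).deleteVerts u).coe with hG'
  have hmem : ∀ x, x ∈ ((⊤ : H.Subgraph).deleteVerts u).verts ↔ x ∉ u := by simp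
  let supp : G'.ConnectedComponent → Finset T := fun c =>
    c.supp.toFinset.map ⟨Subtype.val, Subtype.val_injective⟩
  have hsupp : ∀ c x, x ∈ supp c ↔ ∃ h : x ∈ ((⊤ : H.Subgraph).deleteVerts u).verts,
      (⟨x, h⟩ : ((⊤ : H.Subgraph).deleteVerts u).verts) ∈ c.supp := by
    intro c x; simp [supp]
  have hcard : ∀ c, (supp c).card = c.supp.ncard := by
    intro c
    simp only [supp, Finset.card_map]
    exact (Set.ncard_eq_toFinset_card' _).symm
  have hdisj : ∀ c d x, x ∈ supp c → x ∈ supp d → c = d := by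
    intro c d x hc hd
    obtain ⟨h, hc⟩ := (hsupp c x).1 hc
    obtain ⟨_, hd⟩ := (hsupp d x).1 hd
    exact ConnectedComponent.eq_of_common_vertex hc hd
  have hinj : Function.Injective supp := by
    intro c d hcd
    obtain ⟨x, hx⟩ := c.nonempty_supp
    have hxc : (x : T) ∈ supp c := (hsupp c x).2 ⟨x.2, hx⟩
    exact hdisj c d x hxc (hcd ▸ hxc)
  refine ⟨u.toFinset, G'.oddComponents.toFinset.image supp, ?_, ?_, ?_, ?_, ?_⟩
  · rw [Finset.card_image_of_injective _ hinj, ← Set.ncard_eq_toFinset_card',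
      ← Set.ncard_eq_toFinset_card']
    have hodd := odd_ncard_oddComponents (G := G')
    have hc : Nat.card ((⊤ : H.Subgraph).deleteVerts u).verts + u.ncard = Fintype.card T := by
      rw [← Nat.card_eq_fintype_card, ← Set.ncard_add_ncard_compl u, add_comm]
      congr 1
      rw [Nat.card_coe_set_eq]
      congr 1
      ext x; simp
    rw [← hc] at heven
    rw [← Nat.not_even_iff_odd, ← Nat.not_even_iff_odd, not_iff_not] at hodd
    rw [Nat.even_add] at heven
    by_contra! hlt
    have heq : G'.oddComponents.ncard = u.ncard + 1 := by omega
    rw [heq, heven, Nat.even_add_one] at hodd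
    tauto
  · intro D hD
    simp only [Finset.mem_image, Set.mem_toFinset] at hD
    obtain ⟨c, hc, rfl⟩ := hD
    rw [hcard]; exact hc
  · intro D hD D' hD' hne
    simp only [Finset.coe_image, Set.mem_image] at hD hD'
    obtain ⟨c, -, rfl⟩ := hD
    obtain ⟨d, -, rfl⟩ := hD'
    refine Finset.disjoint_left.2 fun x hx hx' => hne ?_
    rw [hdisj c d x hx hx']
  · intro D hD
    simp only [Finset.mem_image] at hD
    obtain ⟨c, -, rfl⟩ := hD
    refine Finset.disjoint_left.2 fun x hx hx' => ?_
    obtain ⟨h, -⟩ := (hsupp c x).1 hx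
    exact (hmem x).1 h (by simpa using hx')
  · intro D hD x hx y hy hxy
    simp only [Finset.mem_image] at hD
    obtain ⟨c, -, rfl⟩ := hD
    by_contra hyu
    have hyu' : y ∉ u := by simpa using hyu
    obtain ⟨h, hxc⟩ := (hsupp c x).1 hx
    refine hy ((hsupp c y).2 ⟨(hmem y).2 hyu', ?_⟩)
    refine c.mem_supp_of_adj_mem_supp hxc ?_
    have hxu := (hmem x).1 h
    simp [hG', hxu, hyu', hxy]

/-- A weighted sufficient condition for a perfect matching: if vertices have weight at most `5`
and odd sets avoiding a clique `K` have boundary weight at least `5`, up to one defect located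
at the vertex `b`, then there is a perfect matching. -/
theorem exists_isPerfectMatching_of_weight {T : Type*} [Fintype T] [DecidableEq T]
    (H : SimpleGraph T) (heven : Even (Fintype.card T)) (w : T → T → ℕ)
    (hadj : ∀ x y, w x y ≠ 0 → H.Adj x y) (hw : ∀ y, ∑ x, w x y ≤ 5)
    (K : Finset T) (hK : ∀ x ∈ K, ∀ y ∈ K, x ≠ y → H.Adj x y) (b : T)
    (hcut : ∀ D : Finset T, Odd D.card → Disjoint D K →
      5 ≤ ∑ x ∈ D, ∑ y ∈ Dᶜ, w x y ∨ b ∈ D ∧ 1 ≤ ∑ x ∈ D, ∑ y ∈ Dᶜ, w x y) :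
    ∃ M : H.Subgraph, M.IsPerfectMatching := by
  by_contra! hH
  obtain ⟨S, 𝒟, hcard, hodd, hdisj, hS, hout⟩ :=
    H.exists_odd_components_of_no_perfectMatching heven hH
  have hupper : ∑ D ∈ 𝒟, ∑ x ∈ D, ∑ y ∈ Dᶜ, w x y ≤ 5 * S.card := by
    calc ∑ D ∈ 𝒟, ∑ x ∈ D, ∑ y ∈ Dᶜ, w x y
        ≤ ∑ D ∈ 𝒟, ∑ x ∈ D, ∑ y ∈ S, w x y := by
          refine Finset.sum_le_sum fun D hD => Finset.sum_le_sum fun x hx => ?_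
          refine Finset.sum_le_sum_of_ne_zero fun y hy hne => ?_
          exact hout D hD x hx y (Finset.mem_compl.1 hy) (hadj x y hne)
      _ = ∑ x ∈ 𝒟.biUnion id, ∑ y ∈ S, w x y := (Finset.sum_biUnion hdisj).symm
      _ ≤ ∑ x, ∑ y ∈ S, w x y := Finset.sum_le_sum_of_subset (Finset.subset_univ _)
      _ = ∑ y ∈ S, ∑ x, w x y := Finset.sum_comm
      _ ≤ ∑ y ∈ S, 5 := Finset.sum_le_sum fun y _ => hw y
      _ = 5 * S.card := by simp [mul_comm]
  have hlower : ∀ D ∈ 𝒟, 5 ≤ ∑ x ∈ D, ∑ y ∈ Dᶜ, w x y +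
      5 * (if ¬ Disjoint D K then 1 else 0) + 4 * (if b ∈ D then 1 else 0) := by
    intro D hD
    by_cases hDK : Disjoint D K
    · rcases hcut D (hodd D hD) hDK with h | ⟨hb, h⟩
      · omega
      · simp only [hb, if_true]; omega
    · simp only [hDK, not_false_eq_true, if_true]; omega
  have hsum := Finset.sum_le_sum hlower
  simp only [Finset.sum_add_distrib, ← Finset.mul_sum, Finset.sum_boole, Finset.sum_const,
    smul_eq_mul, Nat.cast_id] at hsum
  have h1 : (𝒟.filter fun D => ¬ Disjoint D K).card ≤ 1 := by
    refine Finset.card_le_one.2 fun D hD D' hD' => ?_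
    simp only [Finset.mem_filter, Finset.not_disjoint_iff] at hD hD'
    obtain ⟨hD, x, hxD, hxK⟩ := hD
    obtain ⟨hD', y, hyD, hyK⟩ := hD'
    by_contra hne
    have hd : Disjoint D D' := hdisj hD hD' hne
    have hyD' : y ∉ D := fun h => Finset.disjoint_left.1 hd h hyD
    have hxy : x ≠ y := fun h => hyD' (h ▸ hxD)
    exact Finset.disjoint_left.1 (hS D' hD') hyD
      (hout D hD x hxD y hyD' (hK x hxK y hyK hxy))
  have h2 : (𝒟.filter fun D => b ∈ D).card ≤ 1 := by
    refine Finset.card_le_one.2 fun D hD D' hD' => ?_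
    simp only [Finset.mem_filter] at hD hD'
    by_contra hne
    exact Finset.disjoint_left.1 (hdisj hD.1 hD'.1 hne) hD.2 hD'.2
  omega

end SimpleGraph

section Gadget

variable {W P : Type*} [DecidableEq W] [DecidableEq P]

/-- Edge weights of the matching gadget of a port system: a port sees the three hubs of its
owner with weight `1`, and its mate (or, if the port is free, its own terminal) with weight `2`. -/
def gadgetWeight (own : P → W) (σ : P → P) :
    P ⊕ (W × Fin 3) ⊕ (P ⊕ W) → P ⊕ (W × Fin 3) ⊕ (P ⊕ W) → ℕ
  | .inl p, .inl q => if σ p = q ∧ p ≠ q then 2 else 0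
  | .inl p, .inr (.inl h) => if own p = h.1 then 1 else 0
  | .inr (.inl h), .inl p => if own p = h.1 then 1 else 0
  | .inl p, .inr (.inr (.inl q)) => if p = q ∧ σ p = p then 2 else 0
  | .inr (.inr (.inl q)), .inl p => if p = q ∧ σ p = p then 2 else 0
  | _, _ => 0

/-- The matching gadget: the support of `gadgetWeight` together with a clique on the terminals. -/
def gadgetGraph (own : P → W) (σ : P → P) : SimpleGraph (P ⊕ (W × Fin 3) ⊕ (P ⊕ W)) :=
  SimpleGraph.fromRel fun x y =>
    gadgetWeight own σ x y ≠ 0 ∨ ∃ k l, x = .inr (.inr k) ∧ y = .inr (.inr l)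

theorem gadgetWeight_sum_le [Fintype W] [Fintype P] (own : P → W) (σ : P → P)
    (hσ : ∀ p, σ (σ p) = p) (hown : ∀ v, (Finset.univ.filter fun p => own p = v).card = 5)
    (y : P ⊕ (W × Fin 3) ⊕ (P ⊕ W)) : ∑ x, gadgetWeight own σ x y ≤ 5 := by
  rcases y with q | ⟨v, i⟩ | q | u
  · simp only [Fintype.sum_sum_type, gadgetWeight, Fintype.sum_prod_type]
    have h1 : ∑ p, (if σ p = q ∧ p ≠ q then 2 else 0) + ∑ p, (if q = p ∧ σ q = q then 2 else 0)
        ≤ 2 := by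
      have h : ∀ p, (σ p = q ∧ p ≠ q) ↔ (σ q = p ∧ p ≠ q) := by
        intro p
        refine and_congr_left fun _ => ⟨fun h => ?_, fun h => ?_⟩
        · rw [← h, hσ]
        · rw [← h, hσ]
      simp only [h, ite_and]
      by_cases hq : σ q = q <;> simp [hq]
    have h2 : ∑ v : W, ∑ _i : Fin 3, (if own q = v then 1 else 0) = 3 := by
      simp only [Finset.sum_const, smul_eq_mul, mul_ite, mul_zero]
      simp
    simp only [Finset.sum_const_zero, h2]
    omega
  · simp only [Fintype.sum_sum_type, gadgetWeight]
    simp [hown]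
  · simp only [Fintype.sum_sum_type, gadgetWeight]
    simp only [ite_and]
    simp
    split_ifs <;> simp
  · simp [gadgetWeight]

theorem gadget_cut_lower_bound [Fintype W] [Fintype P] (own : P → W) (σ : P → P)
    (D : Finset (P ⊕ (W × Fin 3) ⊕ (P ⊕ W))) :
    ∑ v, ((Finset.univ.filter fun p => own p = v ∧ .inl p ∈ D).card *
        (Finset.univ.filter fun i => .inr (.inl (v, i)) ∉ D).card +
      (Finset.univ.filter fun i => .inr (.inl (v, i)) ∈ D).card *
        (Finset.univ.filter fun p => own p = v ∧ .inl p ∉ D).card) +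
    (∑ p, ∑ q, (if (.inl p ∈ D ∧ .inl q ∉ D) ∧ σ p = q ∧ p ≠ q then 2 else 0) +
      ∑ p, ∑ q, (if (.inl p ∈ D ∧ .inr (.inr (.inl q)) ∉ D) ∧ p = q ∧ σ p = p then 2 else 0)) ≤
    ∑ x ∈ D, ∑ y ∈ Dᶜ, gadgetWeight own σ x y := by
  have h0 : ∑ x ∈ D, ∑ y ∈ Dᶜ, gadgetWeight own σ x y =
      ∑ x, ∑ y, if x ∈ D ∧ y ∉ D then gadgetWeight own σ x y else 0 := by
    simp only [ite_and, Finset.sum_ite_irrel, Finset.sum_const_zero]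
    rw [← Finset.sum_filter]
    simp only [← Finset.sum_filter]
    simp [Finset.compl_eq_univ_sdiff, Finset.sdiff_eq_filter]
  have h1 : ∑ p : P, ∑ h : W × Fin 3, (if .inl p ∈ D ∧ .inr (.inl h) ∉ D then
        (if own p = h.1 then 1 else 0) else 0) =
      ∑ v, ((Finset.univ.filter fun p => own p = v ∧ .inl p ∈ D).card *
        (Finset.univ.filter fun i => .inr (.inl (v, i)) ∉ D).card) := by
    simp only [Fintype.sum_prod_type]
    rw [Finset.sum_comm]
    refine Finset.sum_congr rfl fun v _ => ?_
    simp only [Finset.card_filter, Finset.sum_mul_sum]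
    refine Finset.sum_congr rfl fun p _ => Finset.sum_congr rfl fun i _ => ?_
    by_cases a : own p = v <;> by_cases b : .inl p ∈ D <;>
      by_cases c : .inr (.inl (v, i)) ∈ D <;> simp [a, b, c]
  have h2 : ∑ h : W × Fin 3, ∑ p : P, (if .inr (.inl h) ∈ D ∧ .inl p ∉ D then
        (if own p = h.1 then 1 else 0) else 0) =
      ∑ v, ((Finset.univ.filter fun i => .inr (.inl (v, i)) ∈ D).card *
        (Finset.univ.filter fun p => own p = v ∧ .inl p ∉ D).card) := by
    simp only [Fintype.sum_prod_type]
    refine Finset.sum_congr rfl fun v _ => ?_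
    simp only [Finset.card_filter, Finset.sum_mul_sum]
    refine Finset.sum_congr rfl fun i _ => Finset.sum_congr rfl fun p _ => ?_
    by_cases a : own p = v <;> by_cases b : .inl p ∈ D <;>
      by_cases c : .inr (.inl (v, i)) ∈ D <;> simp [a, b, c]
  rw [h0, Finset.sum_add_distrib, ← h1, ← h2]
  simp only [Fintype.sum_sum_type (α₁ := P), Fintype.sum_sum_type (α₁ := W × Fin 3),
    gadgetWeight, ite_and, Finset.sum_add_distrib]
  omega

theorem gadget_block_weight (a a' b b' : ℕ) (ha : a + a' = 5) (hb : b + b' = 3) :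
    (a = 0 ∧ b = 0 ∨ a = 5 ∧ b = 3) ∨
      (a * b' + b * a' = 3 ∧ (a = 1 ∧ b = 0 ∨ a = 4 ∧ b = 3)) ∨ 5 ≤ a * b' + b * a' := by
  obtain rfl : a' = 5 - a := by omega
  obtain rfl : b' = 3 - b := by omega
  have : a ≤ 5 := by omega
  have : b ≤ 3 := by omega
  interval_cases a <;> interval_cases b <;> simp

theorem gadget_card_eq [Fintype W] [Fintype P] (own : P → W)
    (D : Finset (P ⊕ (W × Fin 3) ⊕ (P ⊕ W))) (hD : ∀ k, .inr (.inr k) ∉ D) :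
    D.card = ∑ v, ((Finset.univ.filter fun p => own p = v ∧ .inl p ∈ D).card +
      (Finset.univ.filter fun i => .inr (.inl (v, i)) ∈ D).card) := by
  have h : D.card = ∑ x, if x ∈ D then 1 else 0 := by simp
  rw [h, Fintype.sum_sum_type, Fintype.sum_sum_type, Finset.sum_add_distrib]
  simp only [hD, if_false, Finset.sum_const_zero, add_zero, Fintype.sum_prod_type,
    Finset.card_filter]
  congr 1
  rw [Finset.sum_comm]
  refine Finset.sum_congr rfl fun p _ => ?_
  simp only [ite_and]
  simp

/-- Odd vertex sets of the gadget avoiding the terminals have boundary weight at least `5`,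
unless they contain all hubs. -/
theorem gadget_cut [Fintype W] [Fintype P] (own : P → W) (σ : P → P)
    (hσ : ∀ p, σ (σ p) = p) (hown : ∀ v, (Finset.univ.filter fun p => own p = v).card = 5)
    (hcut : ∀ Y : Finset W, Y.Nonempty → Y ≠ Finset.univ →
      2 ≤ (Finset.univ.filter fun p => own p ∈ Y ∧ (σ p = p ∨ own (σ p) ∉ Y)).card)
    (D : Finset (P ⊕ (W × Fin 3) ⊕ (P ⊕ W))) (hodd : Odd D.card)
    (hD : ∀ k, .inr (.inr k) ∉ D) (h : W × Fin 3) :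
    5 ≤ ∑ x ∈ D, ∑ y ∈ Dᶜ, gadgetWeight own σ x y ∨
      .inr (.inl h) ∈ D ∧ 1 ≤ ∑ x ∈ D, ∑ y ∈ Dᶜ, gadgetWeight own σ x y := by
  have hlow := gadget_cut_lower_bound own σ D
  have hcard := gadget_card_eq own D hD
  set a : W → ℕ := fun v => (Finset.univ.filter fun p => own p = v ∧ .inl p ∈ D).card with ha
  set a' : W → ℕ := fun v => (Finset.univ.filter fun p => own p = v ∧ .inl p ∉ D).card with ha'
  set b : W → ℕ := fun v => (Finset.univ.filter fun i => .inr (.inl (v, i)) ∈ D).card with hb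
  set b' : W → ℕ := fun v => (Finset.univ.filter fun i => .inr (.inl (v, i)) ∉ D).card with hb'
  have haa : ∀ v, a v + a' v = 5 := by
    intro v
    rw [← hown v, ← Finset.card_filter_add_card_filter_not (s := Finset.univ.filter _)
      (fun p => .inl p ∈ D), Finset.filter_filter, Finset.filter_filter]
  have hbb : ∀ v, b v + b' v = 3 := by
    intro v
    have := Finset.card_filter_add_card_filter_not (s := (Finset.univ : Finset (Fin 3)))
      (fun i => .inr (.inl (v, i)) ∈ D)
    simpa using this
  set g : W → ℕ := fun v => a v * b' v + b v * a' v with hg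
  have hblock := fun v => gadget_block_weight (a v) (a' v) (b v) (b' v) (haa v) (hbb v)
  by_contra! hcon
  obtain ⟨hlt, hdef⟩ := hcon
  have hsum : ∑ v, g v < 5 := by
    refine lt_of_le_of_lt ?_ hlt
    exact le_trans (Nat.le_add_right _ _) hlow
  have hle : ∀ v, g v ≤ ∑ v, g v := fun v =>
    Finset.single_le_sum (fun _ _ => Nat.zero_le _) (Finset.mem_univ v)
  have hex : ∃ v, g v = 3 ∧ (a v = 1 ∧ b v = 0 ∨ a v = 4 ∧ b v = 3) := by
    by_contra! hno
    have heven : ∀ v, Even (a v + b v) := by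
      intro v
      rcases hblock v with h | h | h
      · rcases h with ⟨h1, h2⟩ | ⟨h1, h2⟩ <;> rw [h1, h2] <;> decide
      · have := hno v h.1
        omega
      · have := hle v
        have : 5 ≤ g v := h
        omega
    rw [hcard] at hodd
    exact Nat.not_even_iff_odd.2 hodd (Finset.even_sum _ fun v _ => heven v)
  obtain ⟨v, hgv, hv⟩ := hex
  have hother : ∀ u, u ≠ v → a u = 0 ∧ b u = 0 ∨ a u = 5 ∧ b u = 3 := by
    intro u huv
    have h2 : g u + g v ≤ ∑ v, g v := by
      rw [← Finset.sum_pair huv]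
      exact Finset.sum_le_sum_of_subset (Finset.subset_univ _)
    rcases hblock u with h | h | h
    · exact h
    · have : g u = 3 := h.1
      omega
    · have : 5 ≤ g u := h
      omega
  have hclosed : ∀ p, .inl p ∈ D → .inl (σ p) ∈ D ∧ σ p ≠ p := by
    intro p hp
    have hge := hle v
    have hlow' : (∑ p, ∑ q, (if (.inl p ∈ D ∧ .inl q ∉ D) ∧ σ p = q ∧ p ≠ q then 2 else 0) +
      ∑ p, ∑ q, (if (.inl p ∈ D ∧ .inr (.inr (.inl q)) ∉ D) ∧ p = q ∧ σ p = p then 2 else 0))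
        < 2 := by
      have : ∑ v, g v + _ ≤ _ := hlow
      omega
    by_cases hfix : σ p = p
    · exfalso
      have h1 := Finset.single_le_sum (f := fun p => ∑ q, (if (.inl p ∈ D ∧
        .inr (.inr (.inl q)) ∉ D) ∧ p = q ∧ σ p = p then 2 else 0))
        (fun _ _ => Nat.zero_le _) (Finset.mem_univ p)
      simp only [hp, hfix, hD, not_false_eq_true, and_true, true_and, Finset.sum_ite_eq,
        Finset.mem_univ, if_true] at h1
      simp only [hD, not_false_eq_true, and_true] at hlow'
      omega
    · refine ⟨?_, hfix⟩
      by_contra hq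
      have h1 := Finset.single_le_sum (f := fun p => ∑ q, (if (.inl p ∈ D ∧
        .inl q ∉ D) ∧ σ p = q ∧ p ≠ q then 2 else 0))
        (fun _ _ => Nat.zero_le _) (Finset.mem_univ p)
      have h2 := Finset.single_le_sum (f := fun q => (if (.inl p ∈ D ∧
        .inl q ∉ D) ∧ σ p = q ∧ p ≠ q then 2 else 0))
        (fun _ _ => Nat.zero_le _) (Finset.mem_univ (σ p))
      have h3 := h2.trans h1
      rw [if_pos ⟨⟨hp, hq⟩, rfl, Ne.symm hfix⟩] at h3
      omega
  have hfull : ∀ p, a (own p) = 5 → .inl p ∈ D := by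
    intro p hp
    have h0 : a' (own p) = 0 := by have := haa (own p); omega
    have := Finset.filter_eq_empty_iff.1 (Finset.card_eq_zero.1 h0) (Finset.mem_univ p)
    simpa using this
  have hpos : ∀ p, .inl p ∈ D → a (own p) ≠ 0 := by
    intro p hp h0
    exact Finset.filter_eq_empty_iff.1 (Finset.card_eq_zero.1 h0) (Finset.mem_univ p) ⟨rfl, hp⟩
  set Y : Finset W := Finset.univ.filter fun u => 4 ≤ a u with hY
  have hYmem : ∀ u, u ∈ Y ↔ 4 ≤ a u := by simp [hY]
  rcases hv with ⟨hav, hbv⟩ | ⟨hav, hbv⟩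
  · obtain ⟨p₀, hp₀⟩ := Finset.card_eq_one.1 hav
    have hmem : ∀ p, own p = v ∧ .inl p ∈ D ↔ p = p₀ := by
      intro p
      have := Finset.ext_iff.1 hp₀ p
      simpa using this
    obtain ⟨hp₀v, hp₀D⟩ := (hmem p₀).2 rfl
    obtain ⟨hσD, hσne⟩ := hclosed p₀ hp₀D
    have hσv : own (σ p₀) ≠ v := fun h => hσne ((hmem _).1 ⟨h, hσD⟩)
    have hvY : v ∉ Y := by rw [hYmem]; omega
    have hσY : own (σ p₀) ∈ Y := by
      rw [hYmem]
      have := hother _ hσv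
      have := hpos _ hσD
      omega
    have h2 := hcut Y ⟨_, hσY⟩ (fun h => hvY (h ▸ Finset.mem_univ v))
    have h1 : (Finset.univ.filter fun p => own p ∈ Y ∧ (σ p = p ∨ own (σ p) ∉ Y)) ⊆ {σ p₀} := by
      intro p hp
      simp only [Finset.mem_filter, Finset.mem_univ, true_and, hYmem] at hp
      have hpv : own p ≠ v := by rintro rfl; omega
      have hpD : .inl p ∈ D := hfull p (by have := hother _ hpv; omega)
      obtain ⟨hpσ, hpne⟩ := hclosed p hpD
      have hlt4 := hp.2.resolve_left hpne
      have hov : own (σ p) = v := by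
        by_contra hne
        have := hother _ hne
        have := hpos _ hpσ
        omega
      rw [Finset.mem_singleton, ← (hmem _).1 ⟨hov, hpσ⟩, hσ]
    have := Finset.card_le_card h1
    simp only [Finset.card_singleton] at this
    omega
  · have hav' : a' v = 1 := by have := haa v; omega
    obtain ⟨p₀, hp₀⟩ := Finset.card_eq_one.1 hav'
    have hmem : ∀ p, own p = v ∧ .inl p ∉ D ↔ p = p₀ := by
      intro p
      have := Finset.ext_iff.1 hp₀ p
      simpa using this
    have hYuniv : Y = Finset.univ := by
      by_contra hne
      have h2 := hcut Y ⟨v, (hYmem v).2 (by omega)⟩ hne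
      have h1 : (Finset.univ.filter fun p => own p ∈ Y ∧ (σ p = p ∨ own (σ p) ∉ Y)) ⊆ {p₀} := by
        intro p hp
        simp only [Finset.mem_filter, Finset.mem_univ, true_and, hYmem] at hp
        rw [Finset.mem_singleton]
        by_cases hpD : .inl p ∈ D
        · exfalso
          obtain ⟨hpσ, hpne⟩ := hclosed p hpD
          have hlt4 := hp.2.resolve_left hpne
          have hov : own (σ p) ≠ v := by rintro h; rw [h] at hlt4; omega
          have := hother _ hov
          have := hpos _ hpσ
          omega
        · refine (hmem p).1 ⟨?_, hpD⟩
          by_contra hne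
          exact hpD (hfull p (by have := hother _ hne; omega))
      have := Finset.card_le_card h1
      simp only [Finset.card_singleton] at this
      omega
    have hb0 : b' h.1 = 0 := by
      have h4 : 4 ≤ a h.1 := (hYmem _).1 (hYuniv ▸ Finset.mem_univ _)
      have := hbb h.1
      by_cases hv : h.1 = v
      · rw [hv] at this ⊢; omega
      · have := hother _ hv
        omega
    have hhD : .inr (.inl h) ∈ D := by
      have := Finset.filter_eq_empty_iff.1 (Finset.card_eq_zero.1 hb0) (Finset.mem_univ h.2)
      simpa using this
    have := hdef hhD
    have := hle v
    have : ∑ v, g v + _ ≤ _ := hlow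
    omega

/-- In a port system whose blocks have five ports and in which every proper nonempty set of
blocks has at least two boundary ports, one can select two ports of each block so that
a port is selected together with its mate. -/
theorem exists_two_ports [Fintype W] [Fintype P] (own : P → W) (σ : P → P)
    (hσ : ∀ p, σ (σ p) = p) (hown : ∀ v, (Finset.univ.filter fun p => own p = v).card = 5)
    (hcut : ∀ Y : Finset W, Y.Nonempty → Y ≠ Finset.univ →
      2 ≤ (Finset.univ.filter fun p => own p ∈ Y ∧ (σ p = p ∨ own (σ p) ∉ Y)).card) :
    ∃ N : Finset P, (∀ p ∈ N, σ p ∈ N) ∧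
      ∀ v, (N.filter fun p => own p = v).card = 2 := by
  classical
  rcases isEmpty_or_nonempty W with hW | ⟨⟨w₀⟩⟩
  · exact ⟨∅, by simp, fun v => hW.elim v⟩
  have hP : Fintype.card P = 5 * Fintype.card W := by
    have := Finset.card_eq_sum_card_fiberwise (f := own) (s := Finset.univ) (t := Finset.univ)
      (fun _ _ => Finset.mem_univ _)
    simp only [hown, Finset.sum_const, Finset.card_univ, smul_eq_mul] at this
    omega
  have hM : ∃ M : (gadgetGraph own σ).Subgraph, M.IsPerfectMatching := by
    refine SimpleGraph.exists_isPerfectMatching_of_weight _ ?_ (gadgetWeight own σ) ?_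
      (gadgetWeight_sum_le own σ hσ hown) (Finset.univ.filter fun x => ∃ k, x = .inr (.inr k)) ?_
      (.inr (.inl (w₀, 0))) ?_
    · simp only [Fintype.card_sum, Fintype.card_prod, Fintype.card_fin, hP]
      exact ⟨7 * Fintype.card W, by ring⟩
    · intro x y hxy
      rw [gadgetGraph, SimpleGraph.fromRel_adj]
      refine ⟨?_, .inl (.inl hxy)⟩
      rintro rfl
      rcases x with p | h | p | u <;> simp [gadgetWeight] at hxy
    · intro x hx y hy hxy
      simp only [Finset.mem_filter, Finset.mem_univ, true_and] at hx hy
      obtain ⟨k, hk⟩ := hx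
      obtain ⟨l, hl⟩ := hy
      rw [gadgetGraph, SimpleGraph.fromRel_adj]
      exact ⟨hxy, .inl (.inr ⟨k, l, hk, hl⟩)⟩
    · intro D hodd hdisj
      refine gadget_cut own σ hσ hown hcut D hodd (fun k hk => ?_) _
      exact Finset.disjoint_left.1 hdisj hk
        (Finset.mem_filter.2 ⟨Finset.mem_univ _, k, rfl⟩)
  obtain ⟨M, hM⟩ := hM
  rw [SimpleGraph.Subgraph.isPerfectMatching_iff] at hM
  have hadj : ∀ p y, M.Adj (.inl p) y → (∃ h, y = .inr (.inl h) ∧ own p = h.1) ∨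
      (y = .inl (σ p) ∧ σ p ≠ p) ∨ (y = .inr (.inr (.inl p)) ∧ σ p = p) := by
    intro p y hy
    have := M.adj_sub hy
    rw [gadgetGraph, SimpleGraph.fromRel_adj] at this
    rcases y with q | h | q | u
    · simp [gadgetWeight] at this
      grind
    · simp [gadgetWeight] at this
      grind
    · simp [gadgetWeight] at this
      grind
    · simp [gadgetWeight] at this
  have hhub : ∀ h, ∃ p, own p = h.1 ∧ M.Adj (.inr (.inl h)) (.inl p) := by
    intro h
    obtain ⟨y, hy, -⟩ := hM (.inr (.inl h))
    have := M.adj_sub hy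
    rw [gadgetGraph, SimpleGraph.fromRel_adj] at this
    rcases y with q | h | q | u
    · simp [gadgetWeight] at this
      exact ⟨q, this, hy⟩
    all_goals simp [gadgetWeight] at this
  choose f hfown hf using hhub
  have hfinj : Function.Injective f := by
    intro h h' hh
    have := (hM (.inl (f h))).unique (hf h).symm (hh ▸ (hf h').symm)
    simpa using this
  refine ⟨Finset.univ.filter fun p => ∀ h, ¬ M.Adj (.inl p) (.inr (.inl h)), ?_, ?_⟩
  · intro p hp
    simp only [Finset.mem_filter, Finset.mem_univ, true_and] at hp ⊢
    by_cases hfix : σ p = p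
    · rwa [hfix]
    intro h hadj'
    obtain ⟨y, hy, -⟩ := hM (.inl p)
    rcases hadj p y hy with ⟨h', rfl, -⟩ | ⟨rfl, -⟩ | ⟨-, h'⟩
    · exact hp h' hy
    · have := (hM (.inl (σ p))).unique hadj' hy.symm
      simp at this
    · exact hfix h'
  · intro v
    have hc := Finset.card_filter_add_card_filter_not (s := Finset.univ.filter fun p => own p = v)
      (fun p => ∀ h, ¬ M.Adj (.inl p) (.inr (.inl h)))
    rw [hown] at hc
    have h3 : (Finset.filter (fun p => ¬ ∀ h, ¬ M.Adj (.inl p) (.inr (.inl h)))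
        (Finset.univ.filter fun p => own p = v)) =
        Finset.univ.image fun i : Fin 3 => f (v, i) := by
      ext p
      simp only [Finset.mem_filter, Finset.mem_univ, true_and, Finset.mem_image, not_forall,
        not_not]
      constructor
      · rintro ⟨hpv, h, hh⟩
        refine ⟨h.2, ?_⟩
        have h1 : own p = h.1 := by
          rcases hadj p _ hh with ⟨h', he, h1⟩ | ⟨he, -⟩ | ⟨he, -⟩
          · simp at he
            rw [h1, he]
          all_goals simp at he
        have h2 := (hM (.inr (.inl h))).unique (hf h) hh.symm
        rw [← hpv, h1]
        simpa using h2
      · rintro ⟨i, rfl⟩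
        exact ⟨hfown _, _, (hf _).symm⟩
    rw [h3, Finset.card_image_of_injective, Finset.card_univ, Fintype.card_fin] at hc
    · rw [Finset.filter_comm]; omega
    · intro i j hij
      simpa using hfinj hij

end Gadget

namespace Multigraph

variable {V E : Type*}

theorem exists_ends_eq (G : Multigraph V E) (e : E) :
    ∃ u v, u ≠ v ∧ ∀ x, x ∈ G.ends e ↔ x = u ∨ x = v := by
  have h := G.loopless e
  induction he : G.ends e with | _ u v
  rw [he] at h
  exact ⟨u, v, by simpa using h, by simp⟩

open Classical in
/-- The edges with exactly one end in `W`. -/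
noncomputable def boundary (G : Multigraph V E) [Fintype E] (W : Finset V) : Finset E :=
  Finset.univ.filter fun e => (∃ v ∈ G.ends e, v ∈ W) ∧ ∃ v ∈ G.ends e, v ∉ W

theorem mem_boundary (G : Multigraph V E) [Fintype E] {W : Finset V} {e : E} :
    e ∈ G.boundary W ↔ (∃ v ∈ G.ends e, v ∈ W) ∧ ∃ v ∈ G.ends e, v ∉ W := by
  simp [boundary]

variable [DecidableEq V]

/-- A set of vertices all of whose nonempty proper subsets have at least two boundary edges
admits an edge set having degree two at each of its vertices. -/
theorem exists_degIn_eq_two (G : Multigraph V E) [Fintype V] [Fintype E]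
    (hreg : ∀ v, G.degree v = 5) (W : Finset V)
    (hW : ∀ Y, Y ⊆ W → Y.Nonempty → Y ≠ W → 2 ≤ (G.boundary Y).card) :
    ∃ M : Finset E, ∀ v ∈ W, G.degIn M v = 2 := by
  classical
  let P := {x : V × E // x.1 ∈ W ∧ x.1 ∈ G.ends x.2}
  let own : P → {v // v ∈ W} := fun p => ⟨p.1.1, p.2.1⟩
  let σ : P → P := fun p =>
    if h : Sym2.Mem.other' p.2.2 ∈ W then
      ⟨(Sym2.Mem.other' p.2.2, p.1.2), h, Sym2.other_mem' p.2.2⟩ else p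
  have hσ_edge : ∀ p, (σ p).1.2 = p.1.2 := by
    intro p; simp only [σ]; split_ifs <;> rfl
  have hother : ∀ p : P, Sym2.Mem.other' p.2.2 ≠ p.1.1 := by
    intro p h
    have h1 := Sym2.other_spec' p.2.2
    rw [h] at h1
    exact G.loopless p.1.2 (h1 ▸ Sym2.mk_isDiag_iff.2 rfl)
  have hends : ∀ (p : P) x, x ∈ G.ends p.1.2 ↔ x = p.1.1 ∨ x = Sym2.Mem.other' p.2.2 := by
    intro p x
    conv_lhs => rw [← Sym2.other_spec' p.2.2]
    rw [Sym2.mem_iff]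
  have hσ_in : ∀ p : P, ∀ x ∈ G.ends p.1.2, x ∈ W → x ≠ p.1.1 → (σ p).1.1 = x := by
    intro p x hx hxW hne
    have := ((hends p x).1 hx).resolve_left hne
    subst this
    simp only [σ, dif_pos hxW]
  have hσ_out : ∀ p : P, ∀ x ∈ G.ends p.1.2, x ∉ W → σ p = p := by
    intro p x hx hxW
    have := ((hends p x).1 hx).resolve_left (fun h => hxW (h ▸ p.2.1))
    subst this
    simp only [σ, dif_neg hxW]
  have hext : ∀ p q : P, p.1.1 = q.1.1 → p.1.2 = q.1.2 → p = q := by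
    intro p q h1 h2
    exact Subtype.ext (Prod.ext h1 h2)
  have hσ : ∀ p, σ (σ p) = p := by
    intro p
    by_cases h : Sym2.Mem.other' p.2.2 ∈ W
    · have h1 := hσ_in p _ (Sym2.other_mem' p.2.2) h (hother p)
      refine hext _ _ ?_ (by rw [hσ_edge, hσ_edge])
      refine hσ_in (σ p) _ ?_ p.2.1 ?_
      · rw [hσ_edge]; exact p.2.2
      · rw [h1]; exact (hother p).symm
    · have := hσ_out p _ (Sym2.other_mem' p.2.2) h
      rw [this, this]
  have hfiber : ∀ (N : Finset P) (v : {v // v ∈ W}), (N.filter fun p => own p = v).card =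
      ((N.filter fun p => own p = v).image fun p => p.1.2).card := by
    intro N v
    refine (Finset.card_image_of_injOn ?_).symm
    intro p hp q hq hpq
    simp only [Finset.coe_filter, Set.mem_ofPred_eq] at hp hq
    refine hext p q ?_ hpq
    exact congrArg Subtype.val (hp.2.trans hq.2.symm)
  have hown : ∀ v, (Finset.univ.filter fun p => own p = v).card = 5 := by
    intro v
    rw [hfiber, ← hreg v, degree, incidence]
    congr 1
    ext e
    simp only [Finset.mem_image, Finset.mem_filter, Finset.mem_univ, true_and]
    constructor
    · rintro ⟨p, rfl, rfl⟩
      exact p.2.2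
    · intro he
      exact ⟨⟨(v, e), v.2, he⟩, rfl, rfl⟩
  have hcut : ∀ Y : Finset {v // v ∈ W}, Y.Nonempty → Y ≠ Finset.univ →
      2 ≤ (Finset.univ.filter fun p => own p ∈ Y ∧ (σ p = p ∨ own (σ p) ∉ Y)).card := by
    intro Y hYne hYuniv
    have hmem : ∀ x, x ∈ Y.map (Function.Embedding.subtype _) ↔ ∃ h : x ∈ W, ⟨x, h⟩ ∈ Y := by
      intro x; simp
    have h2 := hW (Y.map (Function.Embedding.subtype _)) ?_ ?_ ?_
    · refine h2.trans (le_trans (Finset.card_le_card ?_)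
        (Finset.card_image_le (f := fun p : P => p.1.2)))
      intro e he
      obtain ⟨⟨v, hve, hvY⟩, u, hue, huY⟩ := G.mem_boundary.1 he
      obtain ⟨hvW, hvY⟩ := (hmem v).1 hvY
      rw [hmem] at huY
      simp only [Finset.mem_image, Finset.mem_filter, Finset.mem_univ, true_and]
      refine ⟨⟨(v, e), hvW, hve⟩, ⟨hvY, ?_⟩, rfl⟩
      by_cases huW : u ∈ W
      · right
        intro h
        have huv : u ≠ v := by rintro rfl; exact huY ⟨hvW, hvY⟩
        have h1 := hσ_in ⟨(v, e), hvW, hve⟩ u hue huW huv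
        refine huY ⟨huW, ?_⟩
        convert h using 1
        exact Subtype.ext h1.symm
      · exact .inl (hσ_out _ u hue huW)
    · intro x hx
      exact ((hmem x).1 hx).1
    · simpa using hYne
    · intro h
      refine hYuniv (Finset.eq_univ_iff_forall.2 fun x => ?_)
      have hx : (x : V) ∈ Y.map (Function.Embedding.subtype _) := by rw [h]; exact x.2
      exact ((hmem x).1 hx).2
  obtain ⟨N, hN, hN2⟩ := exists_two_ports own σ hσ hown hcut
  refine ⟨N.image fun p => p.1.2, fun v hv => ?_⟩
  rw [← hN2 ⟨v, hv⟩, hfiber, degIn]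
  congr 1
  ext e
  simp only [Finset.mem_image, Finset.mem_filter]
  constructor
  · rintro ⟨⟨p, hp, rfl⟩, hve⟩
    by_cases hpv : v = p.1.1
    · exact ⟨p, ⟨hp, Subtype.ext hpv.symm⟩, rfl⟩
    · exact ⟨σ p, ⟨hN p hp, Subtype.ext (hσ_in p v hve hv hpv)⟩, hσ_edge p⟩
  · rintro ⟨p, ⟨hp, hpv⟩, rfl⟩
    refine ⟨⟨p, hp, rfl⟩, ?_⟩
    have : p.1.1 = v := congrArg Subtype.val hpv
    exact this ▸ p.2.2

/-- If `W` has at most one boundary edge, then an edge set with degree two at the vertices of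
`W` avoids the boundary of `W`. -/
theorem notMem_of_mem_boundary (G : Multigraph V E) [Fintype E] {W : Finset V} {M : Finset E}
    (hM : ∀ v ∈ W, G.degIn M v = 2) (hW : (G.boundary W).card ≤ 1) {e : E}
    (he : e ∈ G.boundary W) : e ∉ M := by
  classical
  intro heM
  have hsum : ∑ v ∈ W, G.degIn M v = ∑ e ∈ M, (W.filter fun v => v ∈ G.ends e).card := by
    simp only [degIn, Finset.card_filter]
    exact Finset.sum_comm
  rw [Finset.sum_congr rfl hM, ← Finset.add_sum_erase _ _ heM] at hsum
  have hone : (W.filter fun v => v ∈ G.ends e).card = 1 := by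
    obtain ⟨u, v, huv, hends⟩ := G.exists_ends_eq e
    obtain ⟨⟨x, hx, hxW⟩, y, hy, hyW⟩ := G.mem_boundary.1 he
    refine Finset.card_eq_one.2 ⟨x, ?_⟩
    ext z
    simp only [Finset.mem_filter, Finset.mem_singleton, hends] at hx hy ⊢
    grind
  have heven : Even (∑ e ∈ M.erase e, (W.filter fun v => v ∈ G.ends e).card) := by
    refine Finset.even_sum _ fun f hf => ?_
    have hfe : f ∉ G.boundary W := fun h =>
      (Finset.mem_erase.1 hf).1 (Finset.card_le_one.1 hW f h e he)
    rw [mem_boundary] at hfe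
    obtain ⟨u, v, huv, hends⟩ := G.exists_ends_eq f
    by_cases hu : u ∈ W
    · have hv : v ∈ W := by
        by_contra hv
        exact hfe ⟨⟨u, by simp [hends], hu⟩, v, by simp [hends], hv⟩
      have : W.filter (fun x => x ∈ G.ends f) = {u, v} := by
        ext z
        simp only [Finset.mem_filter, Finset.mem_insert, Finset.mem_singleton, hends]
        grind
      rw [this, Finset.card_pair huv]
      exact even_two
    · have hv : v ∉ W := by
        intro hv
        exact hfe ⟨⟨v, by simp [hends], hv⟩, u, by simp [hends], hu⟩
      have : W.filter (fun x => x ∈ G.ends f) = ∅ := by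
        ext z
        simp only [Finset.mem_filter, Finset.notMem_empty, hends]
        grind
      rw [this]
      simp
  rw [hone] at hsum
  simp only [Finset.sum_const, smul_eq_mul] at hsum
  obtain ⟨k, hk⟩ := heven
  omega

/-- Minimal nonempty vertex sets with at most one boundary edge. -/
def IsAtom (G : Multigraph V E) [Fintype E] (X : Finset V) : Prop :=
  Minimal (fun Y : Finset V => Y.Nonempty ∧ (G.boundary Y).card ≤ 1) X

theorem IsAtom.eq_of_mem {G : Multigraph V E} [Fintype E] {X Y : Finset V} (hX : G.IsAtom X)
    (hY : G.IsAtom Y) {v : V} (hvX : v ∈ X) (hvY : v ∈ Y) : X = Y := by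
  classical
  by_contra hne
  have key : ∀ {X Y : Finset V}, G.IsAtom X → G.IsAtom Y → X ≠ Y → ∀ v, v ∈ X → v ∈ Y →
      2 ≤ (G.boundary (X \ Y)).card := by
    intro X Y hX hY hne v hvX hvY
    by_contra! hlt
    have hXY : (X \ Y).Nonempty := by
      rw [Finset.sdiff_nonempty]
      exact fun h => hne (h.antisymm (hY.2 hX.1 h))
    have := hX.2 (y := X \ Y) ⟨hXY, by omega⟩ Finset.sdiff_subset hvX
    exact (Finset.mem_sdiff.1 this).2 hvY
  have h1 := key hX hY hne v hvX hvY
  have h2 := key hY hX (Ne.symm hne) v hvY hvX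
  have hu : G.boundary (X \ Y) ∪ G.boundary (Y \ X) ⊆ G.boundary X ∪ G.boundary Y := by
    intro e
    simp only [Finset.mem_union, mem_boundary, Finset.mem_sdiff]
    grind
  have hi : G.boundary (X \ Y) ∩ G.boundary (Y \ X) ⊆ G.boundary X ∩ G.boundary Y := by
    intro e
    obtain ⟨a, b, -, hends⟩ := G.exists_ends_eq e
    simp only [Finset.mem_inter, mem_boundary, Finset.mem_sdiff, hends]
    grind
  have h3 := Finset.card_union_add_card_inter (G.boundary (X \ Y)) (G.boundary (Y \ X))
  have h4 := Finset.card_union_add_card_inter (G.boundary X) (G.boundary Y)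
  have h5 := Finset.card_le_card hu
  have h6 := Finset.card_le_card hi
  have h7 := hX.1.2
  have h8 := hY.1.2
  omega

theorem degIn_eq_of_forall (G : Multigraph V E) [Fintype E] {F M : Finset E} {v : V}
    (h : ∀ e, v ∈ G.ends e → (e ∈ F ↔ e ∈ M)) : G.degIn F v = G.degIn M v := by
  unfold degIn
  congr 1
  ext e
  simp only [Finset.mem_filter]
  exact and_congr_left fun hv => h e hv

theorem degIn_compl (G : Multigraph V E) [Fintype E] [DecidableEq E] (M : Finset E) (v : V) :
    G.degIn M v + G.degIn Mᶜ v = G.degree v := by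
  rw [degIn, degIn, degree, incidence, ← Finset.card_union_of_disjoint]
  · rw [← Finset.filter_union, Finset.union_compl]
  · exact Finset.disjoint_filter_filter disjoint_compl_right

end Multigraph

/-- Every 5-regular graph has a `[2,3]`-factor each of whose connected
components is regular: a spanning subgraph with edge set `F` which is the
vertex-disjoint union of a 2-regular part (on the vertex set `A`) and a
3-regular part (on the complement of `A`), either part possibly empty. -/
theorem five_regular_has_two_three_factor
    {V E : Type*} [Fintype V] [Fintype E] [DecidableEq V]
    (G : Multigraph V E) (hreg : ∀ v, G.degree v = 5) :
    ∃ (F : Finset E) (A : Finset V),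
      (∀ v ∈ A, G.degIn F v = 2) ∧
      (∀ v ∉ A, G.degIn F v = 3) ∧
      (∀ e ∈ F, (∀ v ∈ G.ends e, v ∈ A) ∨ ∀ v ∈ G.ends e, v ∉ A) := by
  classical
  have hatom : ∀ X, G.IsAtom X → ∃ M : Finset E, ∀ v ∈ X, G.degIn M v = 2 := by
    intro X hX
    refine G.exists_degIn_eq_two hreg X fun Y hYX hY hne => ?_
    by_contra! hlt
    exact hne (hYX.antisymm (hX.2 ⟨hY, by omega⟩ hYX))
  obtain ⟨N, hN⟩ := G.exists_degIn_eq_two hreg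
    (Finset.univ.filter fun v => ∀ X, G.IsAtom X → v ∉ X) fun Y hYR hY _ => by
      by_contra! hlt
      obtain ⟨X, hXY, hX⟩ := exists_minimal_le_of_wellFoundedLT
        (fun Y : Finset V => Y.Nonempty ∧ (G.boundary Y).card ≤ 1) Y ⟨hY, by omega⟩
      obtain ⟨v, hv⟩ := hX.1.1
      exact (Finset.mem_filter.1 (hYR (hXY hv))).2 X hX hv
  choose! M hM using hatom
  have hMb : ∀ X, G.IsAtom X → ∀ e ∈ G.boundary X, e ∉ M X := fun X hX e he =>
    G.notMem_of_mem_boundary (hM X hX) hX.1.2 he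
  have hbuniq : ∀ X, G.IsAtom X → ∀ e ∈ G.boundary X, ∀ f ∈ G.boundary X, e = f :=
    fun X hX e he f hf => Finset.card_le_one.1 hX.1.2 e he f hf
  -- An atom is active if its boundary edge is one of the chosen edges of the atom-free part.
  let active : Finset V → Prop := fun X => ∃ e ∈ G.boundary X, e ∉ N ∧
    ∃ u ∈ G.ends e, ∀ X, G.IsAtom X → u ∉ X
  let Q : V → E → Prop := fun v e => ((∀ X, G.IsAtom X → v ∉ X) ∧ e ∉ N) ∨
    ∃ X, G.IsAtom X ∧ v ∈ X ∧ (active X ∧ e ∉ M X ∨ ¬ active X ∧ e ∈ M X)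
  have hQrest : ∀ v e, (∀ X, G.IsAtom X → v ∉ X) → (Q v e ↔ e ∉ N) := by
    intro v e hv
    simp only [Q]
    grind
  have hQatom : ∀ v e X, G.IsAtom X → v ∈ X →
      (Q v e ↔ (active X ∧ e ∉ M X ∨ ¬ active X ∧ e ∈ M X)) := by
    intro v e X hX hv
    constructor
    · rintro (⟨h, -⟩ | ⟨X', hX', hv', h⟩)
      · exact absurd hv (h X hX)
      · rwa [hX.eq_of_mem hX' hv hv']
    · exact fun h => .inr ⟨X, hX, hv, h⟩
  have hQbdry : ∀ v e X, G.IsAtom X → v ∈ X → e ∈ G.boundary X → (Q v e ↔ active X) := by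
    intro v e X hX hv he
    have := hMb X hX e he
    rw [hQatom v e X hX hv]
    simp [this]
  have hactive : ∀ e X u, G.IsAtom X → e ∈ G.boundary X → u ∈ G.ends e →
      u ∉ X → (active X ↔ Q u e) := by
    intro e X u hX he hu huX
    obtain ⟨⟨x, hx, hxX⟩, -⟩ := G.mem_boundary.1 he
    obtain ⟨a, b, -, hends⟩ := G.exists_ends_eq e
    have hpair : ∀ y ∈ G.ends e, y = x ∨ y = u := by
      intro y hy
      rw [hends] at hx hu hy
      grind
    by_cases hu' : ∀ X, G.IsAtom X → u ∉ X
    · rw [hQrest u e hu']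
      constructor
      · rintro ⟨f, hf, hfN, -⟩
        rwa [hbuniq X hX e he f hf]
      · exact fun h => ⟨e, he, h, u, hu, hu'⟩
    · push Not at hu'
      obtain ⟨X', hX', huX'⟩ := hu'
      have hxX' : x ∉ X' := fun h => huX (hX.eq_of_mem hX' hxX h ▸ huX')
      have he' : e ∈ G.boundary X' := G.mem_boundary.2 ⟨⟨u, hu, huX'⟩, x, hx, hxX'⟩
      rw [hQbdry u e X' hX' huX' he']
      have inactive : ∀ Z, G.IsAtom Z → e ∈ G.boundary Z → ¬ active Z := by
        rintro Z hZ heZ ⟨f, hf, -, y, hy, hyR⟩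
        rw [hbuniq Z hZ f hf e heZ] at hy
        rcases hpair y hy with rfl | rfl
        · exact hyR X hX hxX
        · exact hyR X' hX' huX'
      exact iff_of_false (inactive X hX he) (inactive X' hX' he')
  have hQ : ∀ e, ∀ v ∈ G.ends e, ∀ u ∈ G.ends e, Q v e → Q u e := by
    intro e v hv u hu hq
    by_cases hv' : ∀ X, G.IsAtom X → v ∉ X
    · by_cases hu' : ∀ X, G.IsAtom X → u ∉ X
      · rw [hQrest _ _ hv'] at hq
        rwa [hQrest _ _ hu']
      · push Not at hu'
        obtain ⟨X, hX, huX⟩ := hu'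
        have he : e ∈ G.boundary X := G.mem_boundary.2 ⟨⟨u, hu, huX⟩, v, hv, hv' X hX⟩
        rwa [hQbdry u e X hX huX he, hactive e X v hX he hv (hv' X hX)]
    · push Not at hv'
      obtain ⟨X, hX, hvX⟩ := hv'
      by_cases huX : u ∈ X
      · rw [hQatom v e X hX hvX] at hq
        rwa [hQatom u e X hX huX]
      · have he : e ∈ G.boundary X := G.mem_boundary.2 ⟨⟨v, hv, hvX⟩, u, hu, huX⟩
        rwa [hQbdry v e X hX hvX he, hactive e X u hX he hu huX] at hq
  let F : Finset E := Finset.univ.filter fun e => ∃ v ∈ G.ends e, Q v e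
  have hF : ∀ e v, v ∈ G.ends e → (e ∈ F ↔ Q v e) := by
    intro e v hv
    simp only [F, Finset.mem_filter, Finset.mem_univ, true_and]
    exact ⟨fun ⟨u, hu, h⟩ => hQ e u hu v hv h, fun h => ⟨v, hv, h⟩⟩
  let A : Finset V := Finset.univ.filter fun v => ∃ X, G.IsAtom X ∧ v ∈ X ∧ ¬ active X
  have hA : ∀ v, v ∈ A ↔ ∃ X, G.IsAtom X ∧ v ∈ X ∧ ¬ active X := by simp [A]
  refine ⟨F, A, ?_, ?_, ?_⟩
  · intro v hv
    obtain ⟨X, hX, hvX, hna⟩ := (hA v).1 hv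
    rw [← hM X hX v hvX]
    refine G.degIn_eq_of_forall fun e he => ?_
    rw [hF e v he, hQatom v e X hX hvX]
    simp [hna]
  · intro v hv
    rw [hA] at hv
    have hthree : ∀ L : Finset E, G.degIn L v = 2 →
        (∀ e, v ∈ G.ends e → (Q v e ↔ e ∉ L)) → G.degIn F v = 3 := by
      intro L hL hQL
      have h1 := G.degIn_compl L v
      rw [hreg, hL] at h1
      rw [G.degIn_eq_of_forall (M := Lᶜ) fun e he => by
        rw [hF e v he, hQL e he, Finset.mem_compl]]
      omega
    by_cases hv' : ∀ X, G.IsAtom X → v ∉ X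
    · exact hthree N (hN v (by simpa using hv')) fun e _ => hQrest v e hv'
    · push Not at hv'
      obtain ⟨X, hX, hvX⟩ := hv'
      have hact : active X := by
        by_contra h
        exact hv ⟨X, hX, hvX, h⟩
      refine hthree (M X) (hM X hX v hvX) fun e _ => ?_
      rw [hQatom v e X hX hvX]
      simp [hact]
  · intro e he
    by_cases h : ∃ v ∈ G.ends e, v ∈ A
    · left
      obtain ⟨v, hv, hvA⟩ := h
      obtain ⟨X, hX, hvX, hna⟩ := (hA v).1 hvA
      intro u hu
      refine (hA u).2 ⟨X, hX, ?_, hna⟩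
      by_contra huX
      have heb : e ∈ G.boundary X := G.mem_boundary.2 ⟨⟨v, hv, hvX⟩, u, hu, huX⟩
      exact hna ((hQbdry v e X hX hvX heb).1 ((hF e v hv).1 he))
    · right
      push Not at h
      exact h
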